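/- (Modular transformation law of weight-2 theta blocks, part of Theorem 1.1) For every a ∈ ℤ⁴, every τ ∈ ℍ and every z ∈ ℂ, one has φ_{2,a}(τ + 1, z) = φ_{2,a}(τ, z) and φ_{2,a}(−1/τ, z/τ) = τ²·exp(2πi·N(a)·z²/τ)·φ_{2,a}(τ, z); i.e. φ_{2,a} transforms under the generators T and S of SL₂(ℤ) like a Jacobi form of weight 2 and index N(a) with trivial character. -/

import Mathlib

open Complex

/-- The odd Jacobi theta function
`ϑ(τ,z) = e^{πiτ/4}(e^{πiz} − e^{−πiz}) ∏_{n≥1} (1−qⁿe^{2πiz})(1−qⁿe^{−2πiz})(1−qⁿ)`,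
where `q = e^{2πiτ}`. -/
noncomputable def jTheta (τ z : ℂ) : ℂ :=
  Complex.exp (Real.pi * Complex.I * τ / 4) *
    (Complex.exp (Real.pi * Complex.I * z) - Complex.exp (-(Real.pi * Complex.I * z))) *
    ∏' n : ℕ,
      ((1 - Complex.exp (2 * Real.pi * Complex.I * τ) ^ (n + 1) *
            Complex.exp (2 * Real.pi * Complex.I * z)) *
       (1 - Complex.exp (2 * Real.pi * Complex.I * τ) ^ (n + 1) *
            Complex.exp (-(2 * Real.pi * Complex.I * z))) *
       (1 - Complex.exp (2 * Real.pi * Complex.I * τ) ^ (n + 1)))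

/-- The Dedekind eta function `η(τ) = e^{πiτ/12} ∏_{n≥1} (1 − e^{2πinτ})`. -/
noncomputable def dedekindEta (τ : ℂ) : ℂ :=
  Complex.exp (Real.pi * Complex.I * τ / 12) *
    ∏' n : ℕ, (1 - Complex.exp (2 * Real.pi * Complex.I * (n + 1) * τ))

/-- The weight-2 theta block `φ_{2,a}` attached to `a = (a₁,a₂,a₃,a₄) ∈ ℤ⁴`. -/
noncomputable def phi2 (a₁ a₂ a₃ a₄ : ℤ) (τ z : ℂ) : ℂ :=
  dedekindEta τ ^ (-6 : ℤ) *
    (jTheta τ (((2 * a₁ + a₂ + a₄ : ℤ) : ℂ) * z) * jTheta τ ((a₂ : ℂ) * z) *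
      jTheta τ (((a₂ + a₃ : ℤ) : ℂ) * z) * jTheta τ (((a₂ + 2 * a₃ + 2 * a₄ : ℤ) : ℂ) * z) *
      jTheta τ (((a₂ + a₃ + a₄ : ℤ) : ℂ) * z) * jTheta τ (((a₂ + a₃ + 2 * a₄ : ℤ) : ℂ) * z) *
      jTheta τ ((a₃ : ℂ) * z) * jTheta τ (((a₃ + a₄ : ℤ) : ℂ) * z) *
      jTheta τ (((a₃ + 2 * a₄ : ℤ) : ℂ) * z) * jTheta τ ((a₄ : ℂ) * z))

/-- The index `N(a)` of the weight-2 theta block `φ_{2,a}`. -/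
def N2 (a₁ a₂ a₃ a₄ : ℤ) : ℤ :=
  2 * a₁ ^ 2 + 2 * a₁ * a₂ + 2 * a₁ * a₄ + 3 * a₂ ^ 2 + 5 * a₂ * a₃ + 6 * a₂ * a₄ +
    5 * a₃ ^ 2 + 10 * a₃ * a₄ + 8 * a₄ ^ 2


namespace PhiTwo

/-- The finite `q`-Pochhammer symbol `(q;q)_n`. -/
noncomputable def poch (q : ℂ) (n : ℕ) : ℂ := ∏ k ∈ Finset.range n, (1 - q ^ (k + 1))

/-- The reciprocal of `(q;q)_k`, extended by zero to negative integers. -/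
noncomputable def rpoch (q : ℂ) (k : ℤ) : ℂ := if 0 ≤ k then (poch q k.toNat)⁻¹ else 0

/-- The central `q`-binomial coefficient. -/
noncomputable def coef (q : ℂ) (n : ℕ) (m : ℤ) : ℂ :=
  poch q (2 * n) * (rpoch q (n - m) * rpoch q (n + m))

lemma one_sub_pow_ne {q : ℂ} (hq : ‖q‖ < 1) (k : ℕ) : 1 - q ^ (k + 1) ≠ 0 := by
  intro h
  have h1 : q ^ (k + 1) = 1 := (sub_eq_zero.mp h).symm
  have h2 : ‖q‖ ^ (k + 1) = 1 := by rw [← norm_pow, h1, norm_one]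
  have h3 : ‖q‖ ^ (k + 1) < 1 := pow_lt_one₀ (norm_nonneg _) hq (by omega)
  linarith

lemma poch_ne {q : ℂ} (hq : ‖q‖ < 1) (n : ℕ) : poch q n ≠ 0 :=
  Finset.prod_ne_zero_iff.mpr fun k _ => one_sub_pow_ne hq k

lemma poch_succ (q : ℂ) (n : ℕ) : poch q (n + 1) = poch q n * (1 - q ^ (n + 1)) :=
  Finset.prod_range_succ _ _

lemma rpoch_rec {q : ℂ} (hq : ‖q‖ < 1) (k : ℤ) :
    rpoch q (k - 1) = rpoch q k * (1 - q ^ k) := by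
  unfold rpoch
  rcases lt_trichotomy k 0 with h | h | h
  · rw [if_neg (by omega), if_neg (by omega)]; simp
  · subst h; simp
  · obtain ⟨j, rfl⟩ : ∃ j : ℕ, k = j + 1 := ⟨(k - 1).toNat, by omega⟩
    rw [if_pos (by omega), if_pos (by omega)]
    have e1 : ((j : ℤ) + 1 - 1).toNat = j := by omega
    have e2 : ((j : ℤ) + 1).toNat = j + 1 := by omega
    rw [e1, e2, poch_succ]
    have := poch_ne hq j
    have h2 := one_sub_pow_ne hq j
    have e3 : q ^ ((j : ℤ) + 1) = q ^ (j + 1) := by exact_mod_cast zpow_natCast q (j + 1)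
    rw [e3]
    field_simp

lemma coef_zero (q : ℂ) (m : ℤ) : coef q 0 m = if m = 0 then 1 else 0 := by
  unfold coef rpoch
  split_ifs with h1 h2 h3 h4 h5 h6 <;> first | (exfalso; push_cast at *; omega) | simp_all [poch]

lemma coef_rec {q : ℂ} (hq0 : q ≠ 0) (hq : ‖q‖ < 1) (n : ℕ) (m : ℤ) :
    coef q (n + 1) m = (1 + q ^ (2 * n + 1)) * coef q n m
      + q ^ ((n : ℤ) - m + 1) * coef q n (m - 1) + q ^ ((n : ℤ) + m + 1) * coef q n (m + 1) := by
  unfold coef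
  have a1 := rpoch_rec hq ((n : ℤ) + 1 - m)
  have a2 := rpoch_rec hq ((n : ℤ) - m)
  have b1 := rpoch_rec hq ((n : ℤ) + 1 + m)
  have b2 := rpoch_rec hq ((n : ℤ) + m)
  rw [show (n : ℤ) + 1 - m - 1 = n - m by ring] at a1
  rw [show (n : ℤ) + 1 + m - 1 = n + m by ring] at b1
  rw [show 2 * (n + 1) = 2 * n + 1 + 1 by ring, poch_succ, poch_succ,
    show ((n + 1 : ℕ) : ℤ) - m = n + 1 - m by push_cast; ring,
    show ((n + 1 : ℕ) : ℤ) + m = n + 1 + m by push_cast; ring,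
    show (n : ℤ) - (m - 1) = n + 1 - m by ring,
    show (n : ℤ) + (m - 1) = n + m - 1 by ring,
    show (n : ℤ) - (m + 1) = n - m - 1 by ring,
    show (n : ℤ) + (m + 1) = n + 1 + m by ring, a2, b2, a1, b1]
  set A := rpoch q ((n : ℤ) + 1 - m)
  set B := rpoch q ((n : ℤ) + 1 + m)
  have hA : q ^ ((n : ℤ) - m + 1) = q ^ ((n : ℤ) - m) * q := zpow_add_one₀ hq0 _
  have hB : q ^ ((n : ℤ) + m + 1) = q ^ ((n : ℤ) + m) * q := zpow_add_one₀ hq0 _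
  have hab : q ^ (2 * n + 1) = q ^ ((n : ℤ) - m) * q ^ ((n : ℤ) + m) * q := by
    rw [← zpow_add₀ hq0, ← zpow_add_one₀ hq0, ← zpow_natCast]
    congr 1; push_cast; ring
  rw [pow_succ q (2 * n + 1), hab, show (n : ℤ) + 1 - m = n - m + 1 by ring,
    show (n : ℤ) + 1 + m = n + m + 1 by ring, hA, hB]
  ring

lemma poch_tendsto {q : ℂ} (hq : ‖q‖ < 1) :
    ∃ L : ℂ, L ≠ 0 ∧ Filter.Tendsto (poch q) Filter.atTop (nhds L) := by
  refine ⟨∏' n : ℕ, (1 - q ^ (n + 1)), ?_, 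
    (ModularForm.multipliable_one_sub_pow hq).hasProd.tendsto_prod_nat⟩
  have := tprod_one_add_ne_zero_of_summable (R := ℂ) (f := fun n : ℕ => -q ^ (n + 1))
    (fun i => by simpa [← sub_eq_add_neg] using one_sub_pow_ne hq i)
    (by simpa using (summable_nat_add_iff 1).mpr (summable_geometric_of_lt_one (norm_nonneg _) hq))
  simpa [← sub_eq_add_neg] using this

lemma rpoch_bound {q : ℂ} (hq : ‖q‖ < 1) : ∃ C : ℝ, ∀ k, ‖rpoch q k‖ ≤ C := by
  obtain ⟨L, hL, ht⟩ := poch_tendsto hq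
  obtain ⟨C, hC⟩ := (ht.inv₀ hL).norm.bddAbove_range
  refine ⟨C, fun k => ?_⟩
  unfold rpoch
  split_ifs
  · exact hC ⟨_, rfl⟩
  · rw [norm_zero]
    exact (norm_nonneg _).trans (hC ⟨0, rfl⟩)

lemma coef_bound {q : ℂ} (hq : ‖q‖ < 1) : ∃ C : ℝ, ∀ n m, ‖coef q n m‖ ≤ C := by
  obtain ⟨L, hL, ht⟩ := poch_tendsto hq
  obtain ⟨D, hD⟩ := ht.norm.bddAbove_range
  obtain ⟨C, hC⟩ := rpoch_bound hq
  have hC0 : 0 ≤ C := (norm_nonneg _).trans (hC 0)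
  have hD' : ∀ n, ‖poch q n‖ ≤ D := fun n => hD ⟨n, rfl⟩
  have hD0 : 0 ≤ D := (norm_nonneg _).trans (hD' 0)
  refine ⟨D * (C * C), fun n m => ?_⟩
  unfold coef
  rw [norm_mul, norm_mul]
  have := hC (n - m)
  have := hC (n + m)
  have := hD' (2 * n)
  gcongr

lemma rpoch_tendsto {q L : ℂ} (hL : L ≠ 0) (ht : Filter.Tendsto (poch q) Filter.atTop (nhds L))
    (m : ℤ) : Filter.Tendsto (fun n : ℕ => rpoch q (n + m)) Filter.atTop (nhds L⁻¹) := by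
  have h1 : Filter.Tendsto (fun n : ℕ => ((n : ℤ) + m).toNat) Filter.atTop Filter.atTop := by
    rw [Filter.tendsto_atTop]
    intro b
    filter_upwards [Filter.eventually_ge_atTop (b + m.natAbs)] with n hn
    omega
  refine ((ht.comp h1).inv₀ hL).congr' ?_
  filter_upwards [Filter.eventually_ge_atTop m.natAbs] with n hn
  simp only [Function.comp, rpoch]
  rw [if_pos (by omega)]

lemma coef_tendsto {q L : ℂ} (hL : L ≠ 0) (ht : Filter.Tendsto (poch q) Filter.atTop (nhds L))
    (m : ℤ) : Filter.Tendsto (fun n : ℕ => coef q n m) Filter.atTop (nhds L⁻¹) := by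
  have h1 : Filter.Tendsto (fun n : ℕ => 2 * n) Filter.atTop Filter.atTop :=
    Filter.tendsto_id.const_mul_atTop' (by norm_num)
  have := (ht.comp h1).mul ((rpoch_tendsto hL ht (-m)).mul (rpoch_tendsto hL ht m))
  rw [← mul_assoc, mul_inv_cancel₀ hL, one_mul] at this
  refine this.congr fun n => ?_
  simp [coef, sub_eq_add_neg]

lemma term_succ (m : ℤ) (z τ : ℂ) : jacobiTheta₂_term (m + 1) z τ =
    jacobiTheta₂_term m z τ * Complex.exp (2 * Real.pi * I * z + Real.pi * I * (2 * m + 1) * τ) := by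
  unfold jacobiTheta₂_term
  rw [← Complex.exp_add]
  congr 1; push_cast; ring

/-- The finite form of the Jacobi triple product. -/
lemma finite_triple {τ : ℂ} {q : ℂ} (hqd : q = Complex.exp (2 * Real.pi * I * τ))
    (hq : ‖q‖ < 1) (z : ℂ) (n : ℕ) :
    HasSum (fun m : ℤ => coef q n m * jacobiTheta₂_term m z τ)
    (∏ k ∈ Finset.range n, ((1 + Complex.exp (2 * Real.pi * I * z + Real.pi * I * (2 * k + 1) * τ)) *
      (1 + Complex.exp (-(2 * Real.pi * I * z) + Real.pi * I * (2 * k + 1) * τ)))) := by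
  have hq0 : q ≠ 0 := hqd ▸ Complex.exp_ne_zero _
  have hqz : ∀ k : ℤ, q ^ k = Complex.exp (k * (2 * Real.pi * I * τ)) := fun k => by
    rw [hqd, Complex.exp_int_mul]
  induction n with
  | zero =>
    simp only [Finset.range_zero, Finset.prod_empty, coef_zero]
    convert hasSum_ite_eq (0 : ℤ) (1 : ℂ) using 2 with m
    split_ifs with h
    · subst h; simp [jacobiTheta₂_term]
    · simp
  | succ n ih =>
    rw [Finset.prod_range_succ]
    set P := ∏ k ∈ Finset.range n,
      ((1 + Complex.exp (2 * Real.pi * I * z + Real.pi * I * (2 * k + 1) * τ)) *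
      (1 + Complex.exp (-(2 * Real.pi * I * z) + Real.pi * I * (2 * k + 1) * τ))) with hP
    set X := Complex.exp (2 * Real.pi * I * z + Real.pi * I * (2 * n + 1) * τ) with hX
    set Y := Complex.exp (-(2 * Real.pi * I * z) + Real.pi * I * (2 * n + 1) * τ) with hY
    have hXY : X * Y = q ^ (2 * n + 1) := by
      rw [hX, hY, ← Complex.exp_add, ← zpow_natCast, hqz]
      congr 1; push_cast; ring
    have s1 := ih.mul_left (1 + q ^ (2 * n + 1))
    have s2 := (Equiv.hasSum_iff (Equiv.subRight (1 : ℤ))).mpr (ih.mul_left X)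
    have s3 := (Equiv.hasSum_iff (Equiv.addRight (1 : ℤ))).mpr (ih.mul_left Y)
    have := (s1.add s2).add s3
    convert! this using 1
    · funext m
      have t1 : X * jacobiTheta₂_term (m - 1) z τ =
          q ^ ((n : ℤ) - m + 1) * jacobiTheta₂_term m z τ := by
        rw [hX, hqz, jacobiTheta₂_term, jacobiTheta₂_term, ← Complex.exp_add, ← Complex.exp_add]
        congr 1; push_cast; ring
      have t2 : Y * jacobiTheta₂_term (m + 1) z τ =
          q ^ ((n : ℤ) + m + 1) * jacobiTheta₂_term m z τ := by
        rw [hY, hqz, jacobiTheta₂_term, jacobiTheta₂_term, ← Complex.exp_add, ← Complex.exp_add]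
        congr 1; push_cast; ring
      simp only [Function.comp, Equiv.subRight_apply, Equiv.coe_addRight]
      rw [coef_rec hq0 hq]
      linear_combination -coef q n (m - 1) * t1 - coef q n (m + 1) * t2
    · rw [← hXY]; ring

lemma norm_q {τ : ℂ} (hτ : 0 < τ.im) : ‖Complex.exp (2 * Real.pi * I * τ)‖ < 1 := by
  simpa using UpperHalfPlane.norm_exp_two_pi_I_lt_one ⟨τ, hτ⟩

lemma triple_tendsto {τ : ℂ} (hτ : 0 < τ.im) {q : ℂ} (hqd : q = Complex.exp (2 * Real.pi * I * τ))
    (hq : ‖q‖ < 1) (z : ℂ) :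
    Filter.Tendsto (fun n : ℕ => poch q n * ∏ k ∈ Finset.range n,
      ((1 + Complex.exp (2 * Real.pi * I * z + Real.pi * I * (2 * k + 1) * τ)) *
      (1 + Complex.exp (-(2 * Real.pi * I * z) + Real.pi * I * (2 * k + 1) * τ)))) Filter.atTop
      (nhds (jacobiTheta₂ z τ)) := by
  obtain ⟨L, hL, ht⟩ := poch_tendsto hq
  obtain ⟨C, hC⟩ := coef_bound hq
  have hs := (summable_jacobiTheta₂_term_iff z τ).mpr hτ
  have key : Filter.Tendsto (fun n : ℕ => ∑' m : ℤ, coef q n m * jacobiTheta₂_term m z τ)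
      Filter.atTop (nhds (∑' m : ℤ, L⁻¹ * jacobiTheta₂_term m z τ)) := by
    refine tendsto_tsum_of_dominated_convergence
      (bound := fun m => C * ‖jacobiTheta₂_term m z τ‖) (hs.norm.mul_left C) ?_ ?_
    · intro m
      exact (coef_tendsto hL ht m).mul_const _
    · refine Filter.Eventually.of_forall fun n m => ?_
      rw [norm_mul]
      exact mul_le_mul_of_nonneg_right (hC n m) (norm_nonneg _)
  have := ht.mul key
  rw [tsum_mul_left, ← mul_assoc, mul_inv_cancel₀ hL, one_mul] at this
  refine this.congr fun n => ?_
  rw [(finite_triple hqd hq z n).tsum_eq]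

lemma jTheta_eq {τ : ℂ} (hτ : 0 < τ.im) (z : ℂ) :
    jTheta τ z = Complex.exp (Real.pi * I * τ / 4) * Complex.exp (Real.pi * I * z) *
      jacobiTheta₂ (z + τ / 2 + 1 / 2) τ := by
  have hq := norm_q hτ
  unfold jTheta
  obtain ⟨q, hqd⟩ : ∃ q, q = Complex.exp (2 * Real.pi * I * τ) := ⟨_, rfl⟩
  rw [← hqd] at hq ⊢
  obtain ⟨w, hw⟩ : ∃ w, w = Complex.exp (2 * Real.pi * I * z) := ⟨_, rfl⟩
  have hw0 : w ≠ 0 := hw ▸ Complex.exp_ne_zero _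
  have hwi : Complex.exp (-(2 * Real.pi * I * z)) = w⁻¹ := by rw [hw, Complex.exp_neg]
  rw [hwi, ← hw]
  have hm : ∀ c : ℂ, Multipliable fun n : ℕ => 1 - q ^ (n + 1) * c := by
    intro c
    have := multipliable_one_add_of_summable (R := ℂ) (f := fun n : ℕ => -(q ^ (n + 1) * c))
      (by simpa using ((summable_nat_add_iff 1).mpr
        (summable_geometric_of_lt_one (norm_nonneg _) hq)).mul_right ‖c‖)
    simpa [← sub_eq_add_neg] using this
  have hmul : Multipliable fun n : ℕ => (1 - q ^ (n + 1) * w) * (1 - q ^ (n + 1) * w⁻¹) *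
      (1 - q ^ (n + 1)) :=
    ((hm w).mul (hm w⁻¹)).mul (ModularForm.multipliable_one_sub_pow hq)
  have hlim := hmul.hasProd.tendsto_prod_nat
  set P := ∏' n : ℕ, ((1 - q ^ (n + 1) * w) * (1 - q ^ (n + 1) * w⁻¹) * (1 - q ^ (n + 1)))
  have h2 := triple_tendsto hτ hqd hq (z + τ / 2 + 1 / 2)
  have hqn : Filter.Tendsto (fun n : ℕ => 1 - q ^ n * w⁻¹) Filter.atTop (nhds 1) := by
    simpa using ((tendsto_pow_atTop_nhds_zero_of_norm_lt_one hq).mul_const w⁻¹).const_sub 1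
  have h3 := h2.mul hqn
  rw [mul_one] at h3
  have hx : ∀ k : ℕ, Complex.exp (2 * Real.pi * I * (z + τ / 2 + 1 / 2) + Real.pi * I * (2 * k + 1) * τ)
      = -(q ^ (k + 1) * w) := by
    intro k
    rw [hqd, hw, ← Complex.exp_nat_mul, ← Complex.exp_add,
      show 2 * Real.pi * I * (z + τ / 2 + 1 / 2) + Real.pi * I * (2 * k + 1) * τ =
      (((k + 1 : ℕ) : ℂ) * (2 * Real.pi * I * τ) + 2 * Real.pi * I * z) + Real.pi * I by
        push_cast; ring, Complex.exp_add _ (Real.pi * I), Complex.exp_pi_mul_I]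
    ring
  have hy : ∀ k : ℕ, Complex.exp (-(2 * Real.pi * I * (z + τ / 2 + 1 / 2)) +
      Real.pi * I * (2 * k + 1) * τ) = -(q ^ k * w⁻¹) := by
    intro k
    rw [hqd, ← hwi, ← Complex.exp_nat_mul, ← Complex.exp_add,
      show -(2 * Real.pi * I * (z + τ / 2 + 1 / 2)) + Real.pi * I * (2 * k + 1) * τ =
      ((k : ℂ) * (2 * Real.pi * I * τ) + -(2 * Real.pi * I * z)) + -(Real.pi * I) by
        ring, Complex.exp_add _ (-(Real.pi * I)), Complex.exp_neg (Real.pi * I),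
        Complex.exp_pi_mul_I]
    norm_num
  have hfin : ∀ n : ℕ, (1 - w⁻¹) * ∏ k ∈ Finset.range n,
      ((1 - q ^ (k + 1) * w) * (1 - q ^ (k + 1) * w⁻¹) * (1 - q ^ (k + 1))) =
      poch q n * (∏ k ∈ Finset.range n,
      ((1 + Complex.exp (2 * Real.pi * I * (z + τ / 2 + 1 / 2) + Real.pi * I * (2 * k + 1) * τ)) *
      (1 + Complex.exp (-(2 * Real.pi * I * (z + τ / 2 + 1 / 2)) + Real.pi * I * (2 * k + 1) * τ)))) *
      (1 - q ^ n * w⁻¹) := by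
    intro n
    simp only [hx, hy]
    induction n with
    | zero => simp [poch]
    | succ n ih =>
      rw [Finset.prod_range_succ, ← mul_assoc, ih, poch_succ, Finset.prod_range_succ]
      ring
  have hP : (1 - w⁻¹) * P = jacobiTheta₂ (z + τ / 2 + 1 / 2) τ :=
    tendsto_nhds_unique (hlim.const_mul (1 - w⁻¹)) (h3.congr fun n => (hfin n).symm)
  rw [← hP]
  have hE : Complex.exp (Real.pi * I * z) * w⁻¹ = Complex.exp (-(Real.pi * I * z)) := by
    rw [← hwi, ← Complex.exp_add]; congr 1; ring
  rw [← hE]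
  ring

lemma jTheta_S {τ : ℂ} (hτ : 0 < τ.im) (z : ℂ) :
    jTheta (-1 / τ) (z / τ) = -I * (-I * τ) ^ (1 / 2 : ℂ) *
      Complex.exp (Real.pi * I * z ^ 2 / τ) * jTheta τ z := by
  have hτ0 : τ ≠ 0 := by rintro rfl; simp at hτ
  have hτ' : 0 < (-1 / τ).im := by
    simpa [neg_div] using UpperHalfPlane.im_inv_neg_coe_pos ⟨τ, hτ⟩
  rw [jTheta_eq hτ', jTheta_eq hτ, jacobiTheta₂_functional_equation (z + τ / 2 + 1 / 2) τ]
  have e1 : z / τ + -1 / τ / 2 + 1 / 2 = (z + τ / 2 + 1 / 2) / τ + -1 / τ := by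
    field_simp; ring
  rw [e1, jacobiTheta₂_add_left']
  set J := jacobiTheta₂ ((z + τ / 2 + 1 / 2) / τ) (-1 / τ)
  have hs : (-I * τ) ^ (1 / 2 : ℂ) ≠ 0 := by
    rw [Complex.cpow_ne_zero_iff]; left; simp [hτ0]
  set s := (-I * τ) ^ (1 / 2 : ℂ)
  have hI : -I = Complex.exp (-(Real.pi / 2 * I)) := by
    rw [Complex.exp_neg, Complex.exp_pi_div_two_mul_I, Complex.inv_I]
  have key : Complex.exp (Real.pi * I * (-1 / τ) / 4) * Complex.exp (Real.pi * I * (z / τ)) *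
      Complex.exp (-Real.pi * I * (-1 / τ + 2 * ((z + τ / 2 + 1 / 2) / τ))) =
      -I * Complex.exp (Real.pi * I * z ^ 2 / τ) * (Complex.exp (Real.pi * I * τ / 4) * Complex.exp (Real.pi * I * z) *
      Complex.exp (-Real.pi * I * (z + τ / 2 + 1 / 2) ^ 2 / τ)) := by
    rw [hI]
    simp only [← Complex.exp_add]
    congr 1
    field_simp
    ring
  calc _ = (Complex.exp (Real.pi * I * (-1 / τ) / 4) * Complex.exp (Real.pi * I * (z / τ)) *
      Complex.exp (-Real.pi * I * (-1 / τ + 2 * ((z + τ / 2 + 1 / 2) / τ)))) * J := by ring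
    _ = _ := by
      rw [key]
      field_simp

lemma jTheta_T (τ z : ℂ) : jTheta (τ + 1) z = Complex.exp (Real.pi * I / 4) * jTheta τ z := by
  unfold jTheta
  have h1 : Complex.exp (2 * Real.pi * I * (τ + 1)) = Complex.exp (2 * Real.pi * I * τ) := by
    rw [mul_add, mul_one, Complex.exp_add, Complex.exp_two_pi_mul_I, mul_one]
  have h2 : Complex.exp (Real.pi * I * (τ + 1) / 4) =
      Complex.exp (Real.pi * I / 4) * Complex.exp (Real.pi * I * τ / 4) := by
    rw [← Complex.exp_add]; congr 1; ring
  rw [h1, h2]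
  ring

lemma dedekindEta_eq (τ : ℂ) : dedekindEta τ = ModularForm.eta τ := by
  unfold dedekindEta ModularForm.eta
  simp only [ModularForm.eta_q_eq_cexp]
  congr 1
  unfold Function.Periodic.qParam
  congr 1; push_cast; ring

lemma dedekindEta_T (τ : ℂ) :
    dedekindEta (τ + 1) = Complex.exp (Real.pi * I / 12) * dedekindEta τ := by
  unfold dedekindEta
  have h1 : ∀ n : ℕ, Complex.exp (2 * Real.pi * I * (n + 1) * (τ + 1)) =
      Complex.exp (2 * Real.pi * I * (n + 1) * τ) := by
    intro n
    rw [show 2 * Real.pi * I * (n + 1) * (τ + 1) = 2 * Real.pi * I * (n + 1) * τ +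
      ((n + 1 : ℕ) : ℂ) * (2 * Real.pi * I) by push_cast; ring, Complex.exp_add,
      Complex.exp_nat_mul_two_pi_mul_I, mul_one]
  have h2 : Complex.exp (Real.pi * I * (τ + 1) / 12) =
      Complex.exp (Real.pi * I / 12) * Complex.exp (Real.pi * I * τ / 12) := by
    rw [← Complex.exp_add]; congr 1; ring
  simp only [h1, h2]
  ring

lemma dedekindEta_S {τ : ℂ} (hτ : 0 < τ.im) :
    dedekindEta (-1 / τ) ^ 6 = I * τ ^ 3 * dedekindEta τ ^ 6 := by
  have hτ0 : τ ≠ 0 := by rintro rfl; simp at hτ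
  rw [dedekindEta_eq, dedekindEta_eq]
  have h : ModularForm.eta (-1 / τ) = (sqrt I)⁻¹ * (sqrt τ * ModularForm.eta τ) := by
    simpa using ModularForm.eta_comp_eq_csqrt_I_inv (show τ ∈ UpperHalfPlane.upperHalfPlaneSet from hτ)
  have hsq : ∀ x : ℂ, x ≠ 0 → sqrt x ^ 6 = x ^ 3 := by
    intro x hx
    rw [sqrt_eq_exp hx, ← Complex.exp_nat_mul, ← Complex.exp_log hx, ← Complex.exp_nat_mul,
      Complex.exp_log hx]
    congr 1; push_cast; ring
  rw [h, mul_pow, mul_pow, inv_pow, hsq _ I_ne_zero, hsq _ hτ0, Complex.I_pow_three, inv_neg,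
    Complex.inv_I]
  ring

end PhiTwo

open PhiTwo

/-- Modular transformation law of the weight-2 theta block `φ_{2,a}` under the
generators `T` and `S` of `SL₂(ℤ)`: it transforms like a Jacobi form of weight `2`
and index `N(a)` with trivial character. -/
theorem phi2_modular_transformation (a₁ a₂ a₃ a₄ : ℤ) (τ : ℂ) (hτ : 0 < τ.im) (z : ℂ) :
    phi2 a₁ a₂ a₃ a₄ (τ + 1) z = phi2 a₁ a₂ a₃ a₄ τ z ∧
    phi2 a₁ a₂ a₃ a₄ (-1 / τ) (z / τ) =
      τ ^ 2 * Complex.exp (2 * Real.pi * Complex.I * ((N2 a₁ a₂ a₃ a₄ : ℤ) : ℂ) * z ^ 2 / τ) *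
        phi2 a₁ a₂ a₃ a₄ τ z := by
  have hτ0 : τ ≠ 0 := by rintro rfl; simp at hτ
  have hη : dedekindEta τ ≠ 0 := by
    rw [dedekindEta_eq]; exact ModularForm.eta_ne_zero hτ
  have hz6 : ∀ x : ℂ, x ^ (-6 : ℤ) = (x ^ 6)⁻¹ := fun x => by
    rw [zpow_neg]; norm_cast
  constructor
  · unfold phi2
    simp only [jTheta_T, dedekindEta_T, hz6, mul_pow]
    have e1 : Complex.exp (Real.pi * I / 12) ^ 6 = I := by
      rw [← Complex.exp_nat_mul, show ((6 : ℕ) : ℂ) * (Real.pi * I / 12) =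
        Real.pi / 2 * I by push_cast; ring, Complex.exp_pi_div_two_mul_I]
    have e2 : Complex.exp (Real.pi * I / 4) ^ 10 = I := by
      rw [← Complex.exp_nat_mul, show ((10 : ℕ) : ℂ) * (Real.pi * I / 4) =
        Real.pi / 2 * I + 2 * Real.pi * I by push_cast; ring, Complex.exp_add,
        Complex.exp_two_pi_mul_I, Complex.exp_pi_div_two_mul_I, mul_one]
    rw [e1]
    generalize Complex.exp (Real.pi * I / 4) = e at *
    field_simp
    rw [e2]
  · unfold phi2
    have hS : ∀ c : ℂ, jTheta (-1 / τ) (c * (z / τ)) = -I * (-I * τ) ^ (1 / 2 : ℂ) *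
      Complex.exp (Real.pi * I * z ^ 2 / τ * c ^ 2) * jTheta τ (c * z) := by
      intro c
      rw [← mul_div_assoc, jTheta_S hτ]
      congr 3
      ring
    simp only [hS, hz6]
    rw [dedekindEta_S hτ]
    have hs : ((-I * τ) ^ (1 / 2 : ℂ)) ^ 10 = -I * τ ^ 5 := by
      rw [← Complex.cpow_nat_mul]
      norm_num
      rw [neg_pow, mul_pow, pow_succ I 4, Complex.I_pow_four]
      ring
    set s := (-I * τ) ^ (1 / 2 : ℂ)
    have hN : Complex.exp (2 * Real.pi * I * ((N2 a₁ a₂ a₃ a₄ : ℤ) : ℂ) * z ^ 2 / τ) =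
      Complex.exp (Real.pi * I * z ^ 2 / τ * ((2 * a₁ + a₂ + a₄ : ℤ) : ℂ) ^ 2) *
      Complex.exp (Real.pi * I * z ^ 2 / τ * (a₂ : ℂ) ^ 2) *
      Complex.exp (Real.pi * I * z ^ 2 / τ * ((a₂ + a₃ : ℤ) : ℂ) ^ 2) *
      Complex.exp (Real.pi * I * z ^ 2 / τ * ((a₂ + 2 * a₃ + 2 * a₄ : ℤ) : ℂ) ^ 2) *
      Complex.exp (Real.pi * I * z ^ 2 / τ * ((a₂ + a₃ + a₄ : ℤ) : ℂ) ^ 2) *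
      Complex.exp (Real.pi * I * z ^ 2 / τ * ((a₂ + a₃ + 2 * a₄ : ℤ) : ℂ) ^ 2) *
      Complex.exp (Real.pi * I * z ^ 2 / τ * (a₃ : ℂ) ^ 2) *
      Complex.exp (Real.pi * I * z ^ 2 / τ * ((a₃ + a₄ : ℤ) : ℂ) ^ 2) *
      Complex.exp (Real.pi * I * z ^ 2 / τ * ((a₃ + 2 * a₄ : ℤ) : ℂ) ^ 2) *
      Complex.exp (Real.pi * I * z ^ 2 / τ * (a₄ : ℂ) ^ 2) := by
      simp only [← Complex.exp_add]
      congr 1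
      unfold N2
      push_cast
      ring
    rw [hN]
    have hc : (-I * s) ^ 10 * (I * τ ^ 3 * dedekindEta τ ^ 6)⁻¹ =
        τ ^ 2 * (dedekindEta τ ^ 6)⁻¹ := by
      have hI10 : (-I) ^ 10 = -1 := by
        rw [show 10 = 2 * 5 by norm_num, pow_mul, neg_sq, Complex.I_sq]; norm_num
      rw [mul_pow, hs, hI10]
      field_simp
    generalize dedekindEta τ = E at *
    generalize -I * s = u at *
    generalize (I * τ ^ 3 * E ^ 6)⁻¹ = v at *
    generalize (E ^ 6)⁻¹ = y at *
    clear hN hS hs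
    generalize Complex.exp (Real.pi * I * z ^ 2 / τ * ((2 * a₁ + a₂ + a₄ : ℤ) : ℂ) ^ 2) = e0
    generalize jTheta τ (((2 * a₁ + a₂ + a₄ : ℤ) : ℂ) * z) = t0
    generalize Complex.exp (Real.pi * I * z ^ 2 / τ * (a₂ : ℂ) ^ 2) = e1
    generalize jTheta τ ((a₂ : ℂ) * z) = t1
    generalize Complex.exp (Real.pi * I * z ^ 2 / τ * ((a₂ + a₃ : ℤ) : ℂ) ^ 2) = e2
    generalize jTheta τ (((a₂ + a₃ : ℤ) : ℂ) * z) = t2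
    generalize Complex.exp (Real.pi * I * z ^ 2 / τ * ((a₂ + 2 * a₃ + 2 * a₄ : ℤ) : ℂ) ^ 2) = e3
    generalize jTheta τ (((a₂ + 2 * a₃ + 2 * a₄ : ℤ) : ℂ) * z) = t3
    generalize Complex.exp (Real.pi * I * z ^ 2 / τ * ((a₂ + a₃ + a₄ : ℤ) : ℂ) ^ 2) = e4
    generalize jTheta τ (((a₂ + a₃ + a₄ : ℤ) : ℂ) * z) = t4
    generalize Complex.exp (Real.pi * I * z ^ 2 / τ * ((a₂ + a₃ + 2 * a₄ : ℤ) : ℂ) ^ 2) = e5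
    generalize jTheta τ (((a₂ + a₃ + 2 * a₄ : ℤ) : ℂ) * z) = t5
    generalize Complex.exp (Real.pi * I * z ^ 2 / τ * (a₃ : ℂ) ^ 2) = e6
    generalize jTheta τ ((a₃ : ℂ) * z) = t6
    generalize Complex.exp (Real.pi * I * z ^ 2 / τ * ((a₃ + a₄ : ℤ) : ℂ) ^ 2) = e7
    generalize jTheta τ (((a₃ + a₄ : ℤ) : ℂ) * z) = t7
    generalize Complex.exp (Real.pi * I * z ^ 2 / τ * ((a₃ + 2 * a₄ : ℤ) : ℂ) ^ 2) = e8
    generalize jTheta τ (((a₃ + 2 * a₄ : ℤ) : ℂ) * z) = t8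
    generalize Complex.exp (Real.pi * I * z ^ 2 / τ * (a₄ : ℂ) ^ 2) = e9
    generalize jTheta τ ((a₄ : ℂ) * z) = t9
    linear_combination (e0 * t0 * e1 * t1 * e2 * t2 * e3 * t3 * e4 * t4 * e5 * t5 * e6 * t6 * e7 * t7 * e8 * t8 * e9 * t9) * hc
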